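/- For every λ > −1/2, lim_{n→∞} β_λ(n) = (2λ−1)²/8. -/

import Mathlib

open Real

/-- `α_{2n+1}^λ = (2 Γ(n+3/2) Γ(n+1+λ) / ((2n+λ+1) Γ(n+1) Γ(n+λ+1/2)))^{1/2}`, `n ≥ 0`. -/
noncomputable def alphaOdd (lam : ℝ) (n : ℕ) : ℝ :=
  Real.sqrt (2 * Real.Gamma ((n : ℝ) + 3 / 2) * Real.Gamma ((n : ℝ) + 1 + lam) /
    ((2 * (n : ℝ) + lam + 1) * Real.Gamma ((n : ℝ) + 1) * Real.Gamma ((n : ℝ) + lam + 1 / 2)))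

/-- `α_{2n}^λ = (2 n! Γ(n+λ+1/2) / ((2n+λ) Γ(n+1/2) Γ(n+λ)))^{1/2}`, `n ≥ 1`. -/
noncomputable def alphaEven (lam : ℝ) (n : ℕ) : ℝ :=
  Real.sqrt (2 * (n.factorial : ℝ) * Real.Gamma ((n : ℝ) + lam + 1 / 2) /
    ((2 * (n : ℝ) + lam) * Real.Gamma ((n : ℝ) + 1 / 2) * Real.Gamma ((n : ℝ) + lam)))

/-- `α_n^λ`, combining the two parities: `α_{2m}^λ = alphaEven λ m`, `α_{2m+1}^λ = alphaOdd λ m`. -/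
noncomputable def alphaCoef (lam : ℝ) (n : ℕ) : ℝ :=
  if n % 2 = 1 then alphaOdd lam (n / 2) else alphaEven lam (n / 2)

/-- `β_λ(n) = (1 - (α_n^λ)²(1 - 1/(8n²))) n (n+2λ)`. -/
noncomputable def betaCoef (lam : ℝ) (n : ℕ) : ℝ :=
  (1 - (alphaCoef lam n) ^ 2 * (1 - 1 / (8 * (n : ℝ) ^ 2))) * ((n : ℝ) * ((n : ℝ) + 2 * lam))

open Filter Topology

/-- The squared ratio `(Γ(x + 1/2) / Γ(x))²`. -/
noncomputable def gammaRatioSq (x : ℝ) : ℝ := (Real.Gamma (x + 1 / 2) / Real.Gamma x) ^ 2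

lemma gammaRatioSq_pos {x : ℝ} (hx : 0 < x) : 0 < gammaRatioSq x :=
  pow_pos (div_pos (Real.Gamma_pos_of_pos (by linarith)) (Real.Gamma_pos_of_pos hx)) 2

lemma gammaRatioSq_mul_add_half {x : ℝ} (hx : 0 < x) :
    gammaRatioSq x * gammaRatioSq (x + 1 / 2) = x ^ 2 := by
  have h1 := (Real.Gamma_pos_of_pos hx).ne'
  have h2 := (Real.Gamma_pos_of_pos (show 0 < x + 1 / 2 by linarith)).ne'
  unfold gammaRatioSq
  rw [show x + 1 / 2 + 1 / 2 = x + 1 by ring, Real.Gamma_add_one hx.ne']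
  field_simp

lemma gammaRatioSq_add_one {x : ℝ} (hx : 0 < x) :
    gammaRatioSq (x + 1) = ((x + 1 / 2) / x) ^ 2 * gammaRatioSq x := by
  have h1 := (Real.Gamma_pos_of_pos hx).ne'
  have h2 : x + 1 / 2 ≠ 0 := by linarith
  unfold gammaRatioSq
  rw [show x + 1 + 1 / 2 = x + 1 / 2 + 1 by ring, Real.Gamma_add_one hx.ne',
    Real.Gamma_add_one h2]
  field_simp

lemma gammaRatioSq_le_self {x : ℝ} (hx : 0 < x) : gammaRatioSq x ≤ x := by
  have h1 := Real.Gamma_pos_of_pos hx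
  have h := Real.Gamma_mul_add_mul_le_rpow_Gamma_mul_rpow_Gamma hx (show 0 < x + 1 by linarith)
    (show (0 : ℝ) < 1 / 2 by norm_num) (show (0 : ℝ) < 1 / 2 by norm_num) (by norm_num)
  rw [show 1 / 2 * x + 1 / 2 * (x + 1) = x + 1 / 2 by ring, Real.Gamma_add_one hx.ne',
    ← Real.sqrt_eq_rpow, ← Real.sqrt_eq_rpow, ← Real.sqrt_mul h1.le,
    Real.le_sqrt' (Real.Gamma_pos_of_pos (by linarith))] at h
  rw [gammaRatioSq, div_pow, div_le_iff₀ (by positivity)]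
  linarith

lemma tendsto_gammaRatioSq_div_self :
    Tendsto (fun x => gammaRatioSq x / x) atTop (𝓝 1) := by
  have hlow : Tendsto (fun x : ℝ => 1 - 1 / 2 * (x + 1 / 2)⁻¹) atTop (𝓝 1) := by
    have : Tendsto (fun x : ℝ => (x + 1 / 2)⁻¹) atTop (𝓝 0) :=
      tendsto_inv_atTop_zero.comp (tendsto_atTop_add_const_right _ _ tendsto_id)
    convert (this.const_mul (1 / 2)).const_sub 1 using 2
    ring
  refine tendsto_of_tendsto_of_tendsto_of_le_of_le' hlow tendsto_const_nhds ?_ ?_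
  · filter_upwards [eventually_gt_atTop 0] with x hx
    have h1 := gammaRatioSq_mul_add_half hx
    have h2 := gammaRatioSq_le_self (show 0 < x + 1 / 2 by linarith)
    have h3 := mul_le_mul_of_nonneg_left h2 (gammaRatioSq_pos hx).le
    have h4 : 1 - 1 / 2 * (x + 1 / 2)⁻¹ = x / (x + 1 / 2) := by
      have : x + 1 / 2 ≠ 0 := by linarith
      field_simp
      ring
    rw [h4, div_le_div_iff₀ (by linarith) hx]
    nlinarith
  · filter_upwards [eventually_gt_atTop 0] with x hx
    exact (div_le_one hx).2 (gammaRatioSq_le_self hx)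

lemma le_of_le_add_one_of_tendsto {f : ℝ → ℝ} {X l : ℝ} (hf : ∀ x, X ≤ x → f x ≤ f (x + 1))
    (hl : Tendsto f atTop (𝓝 l)) {x : ℝ} (hx : X ≤ x) : f x ≤ l := by
  have hmono : Monotone fun n : ℕ => f (x + n) := monotone_nat_of_le_succ fun n => by
    have := hf (x + n) (by linarith [n.cast_nonneg (α := ℝ)])
    simpa [add_assoc] using this
  have ht : Tendsto (fun n : ℕ => f (x + n)) atTop (𝓝 l) :=
    hl.comp (tendsto_atTop_add_const_left _ _ tendsto_natCast_atTop_atTop)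
  simpa using hmono.ge_of_tendsto ht 0

lemma tendsto_approx_div_self (c : ℝ) :
    Tendsto (fun x : ℝ => (x - 1 / 4 + c / x) / x) atTop (𝓝 1) := by
  have h := tendsto_inv_atTop_zero (𝕜 := ℝ)
  have h' : Tendsto (fun x : ℝ => 1 - 1 / 4 * x⁻¹ + c * (x⁻¹ * x⁻¹)) atTop (𝓝 1) := by
    convert ((h.const_mul (1 / 4)).const_sub 1).add ((h.mul h).const_mul c) using 2
    ring
  refine h'.congr' ?_
  filter_upwards [eventually_gt_atTop 0] with x hx
  field_simp

lemma approx_defect (c : ℝ) {x : ℝ} (hx : 0 < x) :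
    x ^ 2 * (x + 1 - 1 / 4 + c / (x + 1)) - (x + 1 / 2) ^ 2 * (x - 1 / 4 + c / x) =
      1 / 16 - 2 * c + c * ((x + 1)⁻¹ - 1 / 4 * x⁻¹) := by
  have : x + 1 ≠ 0 := by linarith
  field_simp
  ring

lemma tendsto_approx_defect (c : ℝ) :
    Tendsto (fun x : ℝ => 1 / 16 - 2 * c + c * ((x + 1)⁻¹ - 1 / 4 * x⁻¹)) atTop
      (𝓝 (1 / 16 - 2 * c)) := by
  have h := tendsto_inv_atTop_zero (𝕜 := ℝ)
  have h1 : Tendsto (fun x : ℝ => (x + 1)⁻¹) atTop (𝓝 0) :=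
    h.comp (tendsto_atTop_add_const_right _ _ tendsto_id)
  convert ((h1.sub (h.const_mul (1 / 4))).const_mul c).const_add (1 / 16 - 2 * c) using 2
  ring

lemma eventually_approx_pos (c : ℝ) : ∀ᶠ x : ℝ in atTop, 0 < x - 1 / 4 + c / x := by
  filter_upwards [(tendsto_approx_div_self c).eventually_const_lt one_pos,
    eventually_gt_atTop 0] with x h hx
  exact (div_pos_iff_of_pos_right hx).1 h

lemma tendsto_gammaRatioSq_div_approx (c : ℝ) :
    Tendsto (fun x => gammaRatioSq x / (x - 1 / 4 + c / x)) atTop (𝓝 1) := by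
  have h := tendsto_gammaRatioSq_div_self.div (tendsto_approx_div_self c) one_ne_zero
  rw [div_one] at h
  refine h.congr' ?_
  filter_upwards [eventually_gt_atTop 0] with x hx
  exact div_div_div_cancel_right₀ hx.ne' _ _

lemma eventually_gammaRatioSq_le {c : ℝ} (hc : 1 / 32 < c) :
    ∀ᶠ x in atTop, gammaRatioSq x ≤ x - 1 / 4 + c / x := by
  have hd := (tendsto_approx_defect c).eventually_lt_const (show 1 / 16 - 2 * c < 0 by linarith)
  obtain ⟨X, hX⟩ := eventually_atTop.1
    ((eventually_approx_pos c).and (hd.and (eventually_gt_atTop 0)))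
  filter_upwards [eventually_ge_atTop X] with x hx
  rw [← div_le_one (hX x hx).1]
  refine le_of_le_add_one_of_tendsto (X := X) (f := fun x => gammaRatioSq x / (x - 1 / 4 + c / x))
    (fun y hy => ?_) (tendsto_gammaRatioSq_div_approx c) hx
  obtain ⟨h1, h2, h3⟩ := hX y hy
  have h4 := (hX (y + 1) (by linarith)).1
  rw [← approx_defect c h3] at h2
  rw [gammaRatioSq_add_one h3, div_le_div_iff₀ h1 h4, div_pow, div_mul_eq_mul_div,
    div_mul_eq_mul_div, le_div_iff₀ (by positivity)]
  nlinarith [gammaRatioSq_pos h3]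

lemma eventually_le_gammaRatioSq {c : ℝ} (hc : c < 1 / 32) :
    ∀ᶠ x in atTop, x - 1 / 4 + c / x ≤ gammaRatioSq x := by
  have hd := (tendsto_approx_defect c).eventually_const_lt (show 0 < 1 / 16 - 2 * c by linarith)
  obtain ⟨X, hX⟩ := eventually_atTop.1
    ((eventually_approx_pos c).and (hd.and (eventually_gt_atTop 0)))
  filter_upwards [eventually_ge_atTop X] with x hx
  have hlim := (tendsto_gammaRatioSq_div_approx c).inv₀ one_ne_zero
  simp only [inv_div, inv_one] at hlim
  rw [← div_le_one (gammaRatioSq_pos (hX x hx).2.2)]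
  refine le_of_le_add_one_of_tendsto (X := X) (f := fun x => (x - 1 / 4 + c / x) / gammaRatioSq x)
    (fun y hy => ?_) hlim hx
  obtain ⟨h1, h2, h3⟩ := hX y hy
  rw [← approx_defect c h3] at h2
  have h5 := gammaRatioSq_pos h3
  rw [gammaRatioSq_add_one h3, div_le_div_iff₀ h5 (by positivity), div_pow, div_mul_eq_mul_div,
    mul_div_assoc', div_le_iff₀ (by positivity)]
  nlinarith

/-- `(Γ(x + 1/2) / Γ(x))² = x - 1/4 + 1/(32x) + o(1/x)`. -/
lemma tendsto_gammaRatioSq_remainder :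
    Tendsto (fun x => x * (gammaRatioSq x - x + 1 / 4)) atTop (𝓝 (1 / 32)) := by
  refine tendsto_order.2 ⟨fun a ha => ?_, fun a ha => ?_⟩
  · obtain ⟨c, hac, hc⟩ := exists_between ha
    filter_upwards [eventually_le_gammaRatioSq hc, eventually_gt_atTop 0] with x h hx
    have : c / x ≤ gammaRatioSq x - x + 1 / 4 := by linarith
    rw [div_le_iff₀ hx] at this
    linarith
  · obtain ⟨c, hc, hca⟩ := exists_between ha
    filter_upwards [eventually_gammaRatioSq_le hc, eventually_gt_atTop 0] with x h hx
    have : gammaRatioSq x - x + 1 / 4 ≤ c / x := by linarith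
    rw [le_div_iff₀ hx] at this
    linarith

lemma alphaCoef_pow_four {lam : ℝ} (hlam : -1 / 2 < lam) {n : ℕ} (hn : 1 ≤ n) :
    alphaCoef lam n ^ 4 = 4 * gammaRatioSq (((n : ℝ) + 1) / 2) * gammaRatioSq ((n : ℝ) / 2 + lam) /
      ((n : ℝ) + lam) ^ 2 := by
  unfold alphaCoef
  split_ifs with h
  · obtain ⟨m, rfl⟩ : ∃ m, n = 2 * m + 1 := ⟨n / 2, by omega⟩
    have hm : (0 : ℝ) ≤ m := m.cast_nonneg
    have e : (2 * m + 1) / 2 = m := by omega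
    have h1 := Real.Gamma_pos_of_pos (show 0 < (m : ℝ) + 3 / 2 by linarith)
    have h2 := Real.Gamma_pos_of_pos (show 0 < (m : ℝ) + 1 + lam by linarith)
    have h3 := Real.Gamma_pos_of_pos (show 0 < (m : ℝ) + 1 by linarith)
    have h4 := Real.Gamma_pos_of_pos (show 0 < (m : ℝ) + lam + 1 / 2 by linarith)
    have h5 : 0 < 2 * (m : ℝ) + lam + 1 := by linarith
    rw [e, alphaOdd, show ∀ x : ℝ, x ^ 4 = (x ^ 2) ^ 2 by intro x; ring,
      Real.sq_sqrt (by positivity)]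
    unfold gammaRatioSq
    push_cast
    rw [show (2 * (m : ℝ) + 1 + 1) / 2 + 1 / 2 = m + 3 / 2 by ring,
      show (2 * (m : ℝ) + 1 + 1) / 2 = m + 1 by ring,
      show (2 * (m : ℝ) + 1) / 2 + lam + 1 / 2 = m + 1 + lam by ring,
      show (2 * (m : ℝ) + 1) / 2 + lam = m + lam + 1 / 2 by ring,
      show 2 * (m : ℝ) + 1 + lam = 2 * m + lam + 1 by ring]
    field_simp
    ring
  · obtain ⟨m, rfl⟩ : ∃ m, n = 2 * m := ⟨n / 2, by omega⟩
    have hm : (1 : ℝ) ≤ m := by exact_mod_cast (show 1 ≤ m by omega)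
    have e : (2 * m) / 2 = m := by omega
    have h1 := Real.Gamma_pos_of_pos (show 0 < (m : ℝ) + 1 by linarith)
    have h2 := Real.Gamma_pos_of_pos (show 0 < (m : ℝ) + lam + 1 / 2 by linarith)
    have h3 := Real.Gamma_pos_of_pos (show 0 < (m : ℝ) + 1 / 2 by linarith)
    have h4 := Real.Gamma_pos_of_pos (show 0 < (m : ℝ) + lam by linarith)
    have h5 : 0 < 2 * (m : ℝ) + lam := by linarith
    rw [e, alphaEven, ← Real.Gamma_nat_eq_factorial,
      show ∀ x : ℝ, x ^ 4 = (x ^ 2) ^ 2 by intro x; ring, Real.sq_sqrt (by positivity)]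
    unfold gammaRatioSq
    push_cast
    rw [show (2 * (m : ℝ) + 1) / 2 + 1 / 2 = m + 1 by ring,
      show (2 * (m : ℝ) + 1) / 2 = m + 1 / 2 by ring,
      show (2 * (m : ℝ)) / 2 + lam + 1 / 2 = m + lam + 1 / 2 by ring,
      show (2 * (m : ℝ)) / 2 + lam = m + lam by ring]
    field_simp
    ring

/-- `(x + b) / (x + a) → 1` along the natural numbers. -/
lemma tendsto_natCast_add_div_add (a b : ℝ) :
    Tendsto (fun n : ℕ => ((n : ℝ) + b) / (n + a)) atTop (𝓝 1) := by
  have ht : Tendsto (fun n : ℕ => (n : ℝ) + a) atTop atTop :=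
    tendsto_atTop_add_const_right _ _ tendsto_natCast_atTop_atTop
  have h : Tendsto (fun n : ℕ => 1 + (b - a) * ((n : ℝ) + a)⁻¹) atTop (𝓝 1) := by
    simpa using ((tendsto_inv_atTop_zero.comp ht).const_mul (b - a)).const_add 1
  refine h.congr' ?_
  filter_upwards [ht.eventually_gt_atTop 0] with n hn
  field_simp
  ring

lemma tendsto_sq_mul_one_sub_alphaCoef_pow_four {lam : ℝ} (hlam : -1 / 2 < lam) :
    Tendsto (fun n : ℕ => (n : ℝ) ^ 2 * (1 - alphaCoef lam n ^ 4)) atTop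
      (𝓝 (lam ^ 2 - lam)) := by
  have hcast := tendsto_natCast_atTop_atTop (R := ℝ)
  have hx : Tendsto (fun n : ℕ => ((n : ℝ) + 1) / 2) atTop atTop :=
    (tendsto_atTop_add_const_right _ _ hcast).atTop_div_const two_pos
  have hy : Tendsto (fun n : ℕ => (n : ℝ) / 2 + lam) atTop atTop :=
    tendsto_atTop_add_const_right _ _ (hcast.atTop_div_const two_pos)
  have hu := tendsto_gammaRatioSq_remainder.comp hx
  have hv := tendsto_gammaRatioSq_remainder.comp hy
  have hs := tendsto_inv_atTop_zero.comp hx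
  have ht := tendsto_inv_atTop_zero.comp hy
  have key := ((tendsto_natCast_add_div_add lam 0).pow 2).mul
    ((((hu.mul (tendsto_natCast_add_div_add 1 (2 * lam - 1 / 2))).const_mul 4).add
      ((hv.mul (tendsto_natCast_add_div_add (2 * lam) (1 / 2))).const_mul 4)).add
      (((hu.mul hv).mul (hs.mul ht)).const_mul 4) |>.const_sub (lam ^ 2 - lam + 1 / 4))
  convert key.congr' ?_ using 2
  · ring
  · filter_upwards [hy.eventually_gt_atTop 0, eventually_ge_atTop 1] with n hn hn1
    have hn1' : (1 : ℝ) ≤ n := by exact_mod_cast hn1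
    have h1 : (n : ℝ) + 1 ≠ 0 := by linarith
    have h2 : (n : ℝ) + 2 * lam ≠ 0 := by linarith
    have h3 : (n : ℝ) + lam ≠ 0 := by linarith
    rw [alphaCoef_pow_four hlam hn1]
    simp only [Function.comp_apply]
    generalize gammaRatioSq (((n : ℝ) + 1) / 2) = p
    generalize gammaRatioSq ((n : ℝ) / 2 + lam) = q
    obtain ⟨z, rfl⟩ : ∃ z, lam = (z - n) / 2 := ⟨n + 2 * lam, by ring⟩
    have hz : (n : ℝ) + 2 * ((z - n) / 2) = z := by ring
    have hz' : (n : ℝ) / 2 + (z - n) / 2 = z / 2 := by ring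
    have hz'' : (n : ℝ) + (z - n) / 2 = (n + z) / 2 := by ring
    rw [hz] at h2
    replace h3 : (n : ℝ) + z ≠ 0 := fun h => h3 (by rw [hz'', h, zero_div])
    rw [hz, hz', hz'']
    field_simp
    ring

lemma tendsto_alphaCoef_sq {lam : ℝ} (hlam : -1 / 2 < lam) :
    Tendsto (fun n : ℕ => alphaCoef lam n ^ 2) atTop (𝓝 1) := by
  have hinv := tendsto_inv_atTop_zero.comp (tendsto_natCast_atTop_atTop (R := ℝ))
  have h := ((hinv.pow 2).mul (tendsto_sq_mul_one_sub_alphaCoef_pow_four hlam)).const_sub 1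
  have h4 : Tendsto (fun n : ℕ => alphaCoef lam n ^ 4) atTop (𝓝 1) := by
    convert h.congr' ?_ using 2
    · ring
    · filter_upwards [eventually_gt_atTop 0] with n hn
      have : (n : ℝ) ≠ 0 := by exact_mod_cast hn.ne'
      simp only [Function.comp_apply]
      field_simp
      ring
  have := (Real.continuous_sqrt.tendsto 1).comp h4
  rw [Real.sqrt_one] at this
  refine this.congr fun n => ?_
  rw [Function.comp_apply, show alphaCoef lam n ^ 4 = (alphaCoef lam n ^ 2) ^ 2 by ring,
    Real.sqrt_sq (sq_nonneg _)]

/-- **Lemma 3.5 (iii).** For every `λ > -1/2`, `lim_{n→∞} β_λ(n) = (2λ-1)²/8`. -/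
theorem beta_tendsto_limit (lam : ℝ) (hlam : -1 / 2 < lam) :
    Filter.Tendsto (fun n : ℕ => betaCoef lam n) Filter.atTop
      (nhds ((2 * lam - 1) ^ 2 / 8)) := by
  have ha := tendsto_alphaCoef_sq hlam
  have key := ((((tendsto_sq_mul_one_sub_alphaCoef_pow_four hlam).div (ha.const_add 1)
    (by norm_num)).add (ha.div_const 8)).mul (tendsto_natCast_add_div_add 0 (2 * lam)))
  convert key.congr' ?_ using 2
  · ring
  · filter_upwards [eventually_gt_atTop 0] with n hn
    have h0 : (n : ℝ) ≠ 0 := by exact_mod_cast hn.ne'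
    have h1 : 1 + alphaCoef lam n ^ 2 ≠ 0 := by positivity
    simp only [betaCoef, Pi.div_apply, add_zero]
    field_simp
    ring
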